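/- arXiv:2605.04258 — 2 statements merged into one kernel-verified Lean document; each statement's English description precedes it below -/
import Mathlib

section
/- Let i be an index with 1 < i ≤ n, let c := BWT[i], suppose w(i) ≥ 0, and set ℓ* := i if w(i) = LCP[i] and ℓ* := i+1 otherwise, and curr_b := b(ℓ*). If i = Candt_c(curr_b, i+1) and w(i) ≤ LCP[i], then either BWT[j] = c for every index j with curr_b ≤ j < i, or BWT[j] ≠ c for every index j with curr_b ≤ j < i. -/
open scoped Classical

/-- `seg T i len` is the string `T[i..i+len-1]`. -/
def seg (T : ℕ → ℤ) (i len : ℕ) : List ℤ :=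
  (List.range len).map fun k => T (i + k)

/-- `sfx T n p` is the suffix `T[p..n]` of a length-`n` text. -/
def sfx (T : ℕ → ℤ) (n p : ℕ) : List ℤ := seg T p (n + 1 - p)

/-- The reversed text: `Trev T n n = T n` and `Trev T n i = T (n - i)` for `i < n`. -/
def Trev (T : ℕ → ℤ) (n : ℕ) : ℕ → ℤ := fun i => if i = n then T n else T (n - i)

/-- Length of the longest common prefix of two strings. -/
def lcpLen : List ℤ → List ℤ → ℕ
  | a :: l₁, b :: l₂ => if a = b then lcpLen l₁ l₂ + 1 else 0
  | _, _ => 0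

/-- `s` occurs as a substring of `T[1..n]`. -/
def OccursIn (T : ℕ → ℤ) (n : ℕ) (s : List ℤ) : Prop :=
  ∃ i : ℕ, 1 ≤ i ∧ i + s.length ≤ n + 1 ∧ s = seg T i s.length

/-- `s` is a right-maximal substring of `T[1..n]` over the alphabet `{1,…,σ}`. -/
def RightMax (T : ℕ → ℤ) (n σ : ℕ) (s : List ℤ) : Prop :=
  ∃ a b : ℤ, a ≠ b ∧ 1 ≤ a ∧ a ≤ (σ : ℤ) ∧ 1 ≤ b ∧ b ≤ (σ : ℤ) ∧
    OccursIn T n (s ++ [a]) ∧ OccursIn T n (s ++ [b])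

/-- `X` is a suffixient set for `T[1..n]`. -/
def Suffixient (T : ℕ → ℤ) (n σ : ℕ) (X : Set ℕ) : Prop :=
  ∀ s : List ℤ, RightMax T n σ s → ∀ c : ℤ, 1 ≤ c → c ≤ (σ : ℤ) →
    OccursIn T n (s ++ [c]) → ∃ x ∈ X, (s ++ [c]) <:+ seg T 1 x

def StartRun (BWT : ℕ → ℤ) (x : ℕ) : Prop := 1 < x ∧ BWT x ≠ BWT (x - 1)

def EndRun (BWT : ℕ → ℤ) (n x : ℕ) : Prop := x < n ∧ BWT x ≠ BWT (x + 1)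

def RunBoundary (BWT : ℕ → ℤ) (n x : ℕ) : Prop := StartRun BWT x ∨ EndRun BWT n x

/-- `bIdx L x` : the largest index `y < x` with `L y < L x`, or `1` if none exists. -/
noncomputable def bIdx (L : ℕ → ℤ) (x : ℕ) : ℕ :=
  sSup {y : ℕ | (1 ≤ y ∧ y < x ∧ L y < L x) ∨ y = 1}

/-- `eIdx L n x` : the smallest index `y > x` with `L y < L x`, or `n+1` if none exists. -/
noncomputable def eIdx (L : ℕ → ℤ) (n x : ℕ) : ℕ :=
  sInf {y : ℕ | (x < y ∧ y ≤ n ∧ L y < L x) ∨ y = n + 1}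

/-- The maximal weight `w y` over indices `a ≤ y < a'` with `BWT y = c` and `w y ≥ 0`. -/
noncomputable def wMax (BWT w : ℕ → ℤ) (c : ℤ) (a a' : ℕ) : ℤ :=
  (sSup {m : ℕ | ∃ q : ℕ, a ≤ q ∧ q < a' ∧ BWT q = c ∧ 0 ≤ w q ∧ (m : ℤ) = w q} : ℕ)

/-- `Candt BWT w c a a'`: the smallest index `a ≤ p < a'` with `BWT p = c` whose weight
attains the maximum weight among such indices; `-1` if no index
`a ≤ y < a'` with `BWT y = c` and `w y ≥ 0` exists. -/
noncomputable def Candt (BWT w : ℕ → ℤ) (c : ℤ) (a a' : ℕ) : ℤ :=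
  if ∃ p : ℕ, a ≤ p ∧ p < a' ∧ BWT p = c ∧ 0 ≤ w p then
    ((sInf {p : ℕ | a ≤ p ∧ p < a' ∧ BWT p = c ∧ w p = wMax BWT w c a a'} : ℕ) : ℤ)
  else -1

def FullL (n : ℕ) (SA : ℕ → ℕ) (BWT LCP w : ℕ → ℤ) : Set ℕ :=
  { q | ∃ x : ℕ, 1 < x ∧ x ≤ n ∧ BWT x ≠ BWT (x - 1) ∧
      ∃ c : ℤ, (c = BWT x ∨ c = BWT (x - 1)) ∧
      ∃ p : ℕ, (p : ℤ) = Candt BWT w c (bIdx LCP x) (eIdx LCP n x) ∧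
        q = n - SA p + 1 }

/-- Basic assumptions on the text `T[1..n]` over alphabet `{1,…,σ}` with sentinel `dollar`. -/
structure TextSetup (n σ : ℕ) (T : ℕ → ℤ) (dollar : ℤ) : Prop where
  hn : 2 ≤ n
  hsigma : 2 ≤ σ
  hsigma_le : σ ≤ n
  hT : ∀ i, 1 ≤ i → i ≤ n → 1 ≤ T i ∧ T i ≤ (σ : ℤ)
  hTn : T n = dollar
  hTne : ∀ i, 1 ≤ i → i < n → T i ≠ dollar

/-- `SA[1..n]` is the suffix array of the reversed text. -/
structure SASetup (n σ : ℕ) (T : ℕ → ℤ) (dollar : ℤ) (SA : ℕ → ℕ)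
    extends TextSetup n σ T dollar : Prop where
  hSAmem : ∀ i, 1 ≤ i → i ≤ n → 1 ≤ SA i ∧ SA i ≤ n
  hSAinj : ∀ i j, 1 ≤ i → i ≤ n → 1 ≤ j → j ≤ n → SA i = SA j → i = j
  hSAsurj : ∀ p, 1 ≤ p → p ≤ n → ∃ i, 1 ≤ i ∧ i ≤ n ∧ SA i = p
  hSAord : ∀ i j, 1 ≤ i → i < j → j ≤ n →
    List.Lex (· < ·) (sfx (Trev T n) n (SA i)) (sfx (Trev T n) n (SA j))

/-- `LCP[1..n]` is the LCP array of the reversed text. -/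
structure LCPSetup (n σ : ℕ) (T : ℕ → ℤ) (dollar : ℤ) (SA : ℕ → ℕ) (LCP : ℕ → ℤ)
    extends SASetup n σ T dollar SA : Prop where
  hLCP1 : LCP 1 = -1
  hLCP : ∀ i, 1 < i → i ≤ n →
    LCP i = (lcpLen (sfx (Trev T n) n (SA (i - 1))) (sfx (Trev T n) n (SA i)) : ℤ)
  hLCPend : LCP (n + 1) = -1

/-- Additionally, `BWT[1..n]` is the BWT of the reversed text and `w` is the weight function. -/
structure FullSetup (n σ : ℕ) (T : ℕ → ℤ) (dollar : ℤ) (SA : ℕ → ℕ)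
    (BWT LCP w : ℕ → ℤ) extends LCPSetup n σ T dollar SA LCP : Prop where
  hBWT : ∀ i, 1 ≤ i → i ≤ n → BWT i = T (n - SA i + 1)
  hBWTend : BWT (n + 1) = -1
  hwNot : ∀ x, 1 ≤ x → x ≤ n → ¬ RunBoundary BWT n x → w x = -1
  hwRB : ∀ x, 1 ≤ x → x ≤ n → RunBoundary BWT n x →
    (∃ s : List ℤ, RightMax T n σ s ∧ s <:+ seg T 1 (n - SA x)) →
    IsGreatest {m : ℤ | ∃ s : List ℤ, RightMax T n σ s ∧ s <:+ seg T 1 (n - SA x) ∧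
      m = (s.length : ℤ)} (w x)

/-- `sIdx`: the minimum index `i ∈ [1..n]` such that `T[n-SA[ℓ]+1-w(ℓ)..n-SA[ℓ]]`
is a suffix of `T[1..n-SA[i]]`. -/
noncomputable def sIdx (T : ℕ → ℤ) (n : ℕ) (SA : ℕ → ℕ) (w : ℕ → ℤ) (l : ℕ) : ℕ :=
  sInf {i : ℕ | 1 ≤ i ∧ i ≤ n ∧
    seg T (n - SA l + 1 - (w l).toNat) (w l).toNat <:+ seg T 1 (n - SA i)}

/-- `tIdx`: the maximum such index. -/
noncomputable def tIdx (T : ℕ → ℤ) (n : ℕ) (SA : ℕ → ℕ) (w : ℕ → ℤ) (l : ℕ) : ℕ :=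
  sSup {i : ℕ | 1 ≤ i ∧ i ≤ n ∧
    seg T (n - SA l + 1 - (w l).toNat) (w l).toNat <:+ seg T 1 (n - SA i)}

/-- `pIdx c i`: the largest index `j < i` with `w j > -1` and `BWT j = c`, or `0`. -/
noncomputable def pIdx (BWT w : ℕ → ℤ) (c : ℤ) (i : ℕ) : ℕ :=
  sSup {j : ℕ | (1 ≤ j ∧ j < i ∧ -1 < w j ∧ BWT j = c) ∨ j = 0}

/-- `pW c i`: the weight of `pIdx c i`, or `-1` if no index as in `pIdx` exists. -/
noncomputable def pW (BWT w : ℕ → ℤ) (c : ℤ) (i : ℕ) : ℤ :=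
  if ∃ j : ℕ, 1 ≤ j ∧ j < i ∧ -1 < w j ∧ BWT j = c then w (pIdx BWT w c i) else -1

/-- `α` is colexicographically smaller than `β`. -/
def ColexLt (α β : List ℤ) : Prop :=
  (α ≠ β ∧ α <:+ β) ∨
  ∃ k : ℕ, 1 ≤ k ∧ k ≤ α.length ∧ k ≤ β.length ∧
    (∀ i, 1 ≤ i → i < k → α.getD (α.length - i) 0 = β.getD (β.length - i) 0) ∧
    α.getD (α.length - k) 0 < β.getD (β.length - k) 0

theorem length_seg (T : ℕ → ℤ) (i len : ℕ) : (seg T i len).length = len := by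
  simp [seg]

theorem drop_seg (T : ℕ → ℤ) (i len k : ℕ) :
    (seg T i len).drop k = seg T (i + k) (len - k) := by
  apply List.ext_getElem
  · simp [seg]
  · intro j h1 h2
    simp [seg, Nat.add_assoc]

theorem seg_append_singleton (T : ℕ → ℤ) (i len : ℕ) :
    seg T i len ++ [T (i + len)] = seg T i (len + 1) := by
  simp [seg, List.range_succ]

theorem sfx_Trev (T : ℕ → ℤ) {n p : ℕ} (hpn : p ≤ n) :
    sfx (Trev T n) n p = (seg T 1 (n - p)).reverse ++ [T n] := by
  apply List.ext_getElem
  · simp [sfx, seg]; omega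
  · intro j h1 h2
    simp only [sfx, seg, List.length_map, List.length_range] at h1
    by_cases hj : j < n - p
    · rw [List.getElem_append_left (by simpa [seg] using hj)]
      simp only [sfx, seg, Trev, List.getElem_map, List.getElem_range, List.getElem_reverse,
        List.length_map, List.length_range]
      rw [if_neg (by omega)]
      congr 1
      omega
    · have hj' : p + j = n := by omega
      rw [List.getElem_append_right (by simp [seg]; omega)]
      simp [sfx, seg, Trev, hj']

/-- The longest common prefix of two strings terminated by a sentinel avoids the sentinel. -/
theorem lcpLen_append_sentinel (d : ℤ) : ∀ A B : List ℤ, d ∉ A → d ∉ B → A ≠ B →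
    ∃ s, s.length = lcpLen (A ++ [d]) (B ++ [d]) ∧ s <+: A ∧ s <+: B
  | [], [], _, _, h => absurd rfl h
  | [], b :: B, _, hB, _ => ⟨[], by
      have : d ≠ b := fun h => hB (by simp [h])
      simp [lcpLen, this]⟩
  | a :: A, [], hA, _, _ => ⟨[], by
      have : a ≠ d := fun h => hA (by simp [h])
      simp [lcpLen, this]⟩
  | a :: A, b :: B, hA, hB, h => by
      by_cases hab : a = b
      · subst hab
        obtain ⟨s, hs, h1, h2⟩ := lcpLen_append_sentinel d A B
          (fun h => hA (List.mem_cons_of_mem _ h)) (fun h => hB (List.mem_cons_of_mem _ h))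
          (fun h' => h (by rw [h']))
        exact ⟨a :: s, by simp [lcpLen, hs], by simpa using h1, by simpa using h2⟩
      · exact ⟨[], by simp [lcpLen, hab]⟩

theorem length_le_lcpLen : ∀ s A B : List ℤ, s <+: A → s <+: B → s.length ≤ lcpLen A B
  | [], _, _, _, _ => by simp
  | a :: s, A, B, hA, hB => by
      obtain ⟨A', rfl⟩ := hA
      obtain ⟨B', rfl⟩ := hB
      simpa [lcpLen] using
        length_le_lcpLen s _ _ (List.prefix_append s A') (List.prefix_append s B')

/-- The strings with a given prefix form a lexicographic interval. -/
theorem prefix_of_lex_between : ∀ s A B C : List ℤ, s <+: A → s <+: C →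
    (List.Lex (· < ·) A B ∨ A = B) → (List.Lex (· < ·) B C ∨ B = C) → s <+: B
  | [], _, _, _, _, _, _, _ => List.nil_prefix
  | a :: s, A, B, C, hA, hC, hAB, hBC => by
      rcases hAB with hAB | rfl
      swap
      · exact hA
      rcases hBC with hBC | rfl
      swap
      · exact hC
      obtain ⟨A', rfl⟩ := hA
      obtain ⟨C', rfl⟩ := hC
      rw [List.cons_append] at hAB hBC
      cases hAB with
      | cons h =>
        cases hBC with
        | cons h' =>
          simpa using prefix_of_lex_between s _ _ _ (List.prefix_append s A')
            (List.prefix_append s C') (Or.inl h) (Or.inl h')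
        | rel h' => exact absurd h' (lt_irrefl _)
      | rel h =>
        cases hBC with
        | cons h' => exact absurd h (lt_irrefl _)
        | rel h' => exact absurd (h.trans h') (lt_irrefl _)

theorem bddAbove_bIdx_set (L : ℕ → ℤ) (x : ℕ) :
    BddAbove {y : ℕ | (1 ≤ y ∧ y < x ∧ L y < L x) ∨ y = 1} := by
  refine ⟨max x 1, ?_⟩
  rintro y (⟨-, h, -⟩ | rfl)
  · exact le_max_of_le_left h.le
  · exact le_max_right _ _

theorem bIdx_pos (L : ℕ → ℤ) (x : ℕ) : 1 ≤ bIdx L x :=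
  le_csSup (bddAbove_bIdx_set L x) (Or.inr rfl)

theorem le_of_bIdx_lt {L : ℕ → ℤ} {x y : ℕ} (h : bIdx L x < y) (hyx : y < x) : L x ≤ L y := by
  by_contra! hlt
  have hy : 1 ≤ y := (Nat.zero_le _).trans_lt h
  exact absurd h (not_lt.2 (le_csSup (bddAbove_bIdx_set L x) (Or.inl ⟨hy, hyx, hlt⟩)))

/-- The weight at the candidate strictly dominates every earlier nonnegative weight. -/
theorem weight_lt_of_eq_Candt {BWT w : ℕ → ℤ} {c : ℤ} {a a' i j : ℕ}
    (h : (i : ℤ) = Candt BWT w c a a') (haj : a ≤ j) (hji : j < i) (hja : j < a')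
    (hc : BWT j = c) (hw : 0 ≤ w j) : w j < w i := by
  have hex : ∃ p : ℕ, a ≤ p ∧ p < a' ∧ BWT p = c ∧ 0 ≤ w p := ⟨j, haj, hja, hc, hw⟩
  set M : Set ℕ := {m : ℕ | ∃ q : ℕ, a ≤ q ∧ q < a' ∧ BWT q = c ∧ 0 ≤ w q ∧ (m : ℤ) = w q}
    with hM
  have hbdd : BddAbove M := by
    refine ((Set.finite_Iio a').image (fun q => (w q).toNat)).bddAbove.mono ?_
    rintro m ⟨q, -, hq, -, -, hm⟩
    exact ⟨q, hq, by simp [← hm]⟩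
  have hjM : (w j).toNat ∈ M := ⟨j, haj, hja, hc, hw, Int.toNat_of_nonneg hw⟩
  have hle : w j ≤ wMax BWT w c a a' := by
    have := le_csSup hbdd hjM
    rw [wMax, ← hM]
    omega
  have hne : {p : ℕ | a ≤ p ∧ p < a' ∧ BWT p = c ∧ w p = wMax BWT w c a a'}.Nonempty := by
    obtain ⟨q, h1, h2, h3, -, h5⟩ := Nat.sSup_mem ⟨_, hjM⟩ hbdd
    exact ⟨q, h1, h2, h3, h5.symm⟩
  rw [Candt, if_pos hex, Nat.cast_inj] at h
  have hi := Nat.sInf_mem hne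
  rw [← h] at hi
  rw [hi.2.2.2]
  refine lt_of_le_of_ne hle fun heq => ?_
  have : i ≤ j := h ▸ Nat.sInf_le ⟨haj, hja, hc, heq⟩
  omega

/-- A predicate that fails at `j` and holds at `m ≥ j` has a last failure in `[j, m)`, after
which it holds up to `m`. -/
theorem exists_last_switch {P : ℕ → Prop} {m j : ℕ} (hj : j < m + 1) (hPj : ¬ P j)
    (hPm : P m) : ∃ k, j ≤ k ∧ k + 1 < m + 1 ∧ ¬ P k ∧ P (k + 1) ∧
      ∀ x, k < x → x < m + 1 → P x := by
  have hjm : j ≤ m := Nat.le_of_lt_succ hj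
  have hspec : ¬ P (Nat.findGreatest (fun x => ¬ P x) m) :=
    Nat.findGreatest_spec (P := fun x => ¬ P x) hjm hPj
  have hlt : Nat.findGreatest (fun x => ¬ P x) m < m :=
    lt_of_le_of_ne (Nat.findGreatest_le m) fun heq => by rw [heq] at hspec; exact hspec hPm
  have hafter : ∀ x, Nat.findGreatest (fun x => ¬ P x) m < x → x < m + 1 → P x :=
    fun x hx hxm => not_not.1 (Nat.findGreatest_is_greatest hx (by omega))
  exact ⟨_, Nat.le_findGreatest hjm hPj, by omega, hspec, hafter _ (by omega) (by omega), hafter⟩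

theorem occursIn_append_singleton {T : ℕ → ℤ} {n : ℕ} {s : List ℤ} {a : ℤ} :
    OccursIn T n (s ++ [a]) ↔ ∃ q, q + 1 ≤ n ∧ s <:+ seg T 1 q ∧ T (q + 1) = a := by
  constructor
  · rintro ⟨i, hi, hlen, hs⟩
    rw [List.length_append, List.length_singleton] at hlen hs
    rw [← seg_append_singleton] at hs
    obtain ⟨h1, h2⟩ := List.append_inj' hs rfl
    refine ⟨i + s.length - 1, by omega, ?_, ?_⟩
    · have := List.drop_suffix (i - 1) (seg T 1 (i + s.length - 1))
      rw [drop_seg, show 1 + (i - 1) = i by omega,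
        show i + s.length - 1 - (i - 1) = s.length by omega] at this
      rwa [← h1] at this
    · rw [List.singleton_inj.1 h2]
      congr 1
      omega
  · rintro ⟨q, hq, hs, rfl⟩
    have hlen := hs.length_le
    rw [length_seg] at hlen
    rw [List.suffix_iff_eq_drop, length_seg, drop_seg, Nat.sub_sub_self hlen] at hs
    refine ⟨1 + (q - s.length), by omega, by simp; omega, ?_⟩
    rw [List.length_append, List.length_singleton, ← seg_append_singleton, ← hs]
    congr 3
    omega

section

variable {n σ : ℕ} {T : ℕ → ℤ} {dollar : ℤ} {SA : ℕ → ℕ} {BWT LCP w : ℕ → ℤ}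

theorem FullSetup.occursIn_append_singleton_iff (h : FullSetup n σ T dollar SA BWT LCP w)
    {s : List ℤ} {a : ℤ} : OccursIn T n (s ++ [a]) ↔
      ∃ p, 1 ≤ p ∧ p ≤ n ∧ s <:+ seg T 1 (n - SA p) ∧ BWT p = a := by
  rw [occursIn_append_singleton]
  constructor
  · rintro ⟨q, hq, hs, ha⟩
    obtain ⟨p, hp, hpn, hSA⟩ := h.hSAsurj (n - q) (by omega) (by omega)
    have hnq : n - SA p = q := by omega
    exact ⟨p, hp, hpn, by rwa [hnq], by rw [h.hBWT p hp hpn, hnq, ha]⟩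
  · rintro ⟨p, hp, hpn, hs, ha⟩
    have := h.hSAmem p hp hpn
    exact ⟨n - SA p, by omega, hs, by rw [← ha, h.hBWT p hp hpn]⟩

theorem FullSetup.rightMax_of_suffix (h : FullSetup n σ T dollar SA BWT LCP w)
    {s : List ℤ} {p q : ℕ} (hp : 1 ≤ p) (hpn : p ≤ n) (hq : 1 ≤ q) (hqn : q ≤ n)
    (hsp : s <:+ seg T 1 (n - SA p)) (hsq : s <:+ seg T 1 (n - SA q)) (hne : BWT p ≠ BWT q) :
    RightMax T n σ s := by
  have hmem : ∀ x, 1 ≤ x → x ≤ n → 1 ≤ BWT x ∧ BWT x ≤ σ := fun x hx hxn => by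
    have := h.hSAmem x hx hxn
    rw [h.hBWT x hx hxn]
    exact h.hT _ (by omega) (by omega)
  exact ⟨BWT p, BWT q, hne, (hmem p hp hpn).1, (hmem p hp hpn).2, (hmem q hq hqn).1,
    (hmem q hq hqn).2, h.occursIn_append_singleton_iff.2 ⟨p, hp, hpn, hsp, rfl⟩,
    h.occursIn_append_singleton_iff.2 ⟨q, hq, hqn, hsq, rfl⟩⟩

theorem FullSetup.exists_ne_of_rightMax (h : FullSetup n σ T dollar SA BWT LCP w)
    {s : List ℤ} (hs : RightMax T n σ s) (c : ℤ) :
    ∃ p, 1 ≤ p ∧ p ≤ n ∧ s <:+ seg T 1 (n - SA p) ∧ BWT p ≠ c := by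
  obtain ⟨a, b, hab, -, -, -, -, ha, hb⟩ := hs
  obtain ⟨p, hp, hpn, hsp, rfl⟩ := h.occursIn_append_singleton_iff.1 ha
  obtain ⟨q, hq, hqn, hsq, rfl⟩ := h.occursIn_append_singleton_iff.1 hb
  by_cases hpc : BWT p = c
  · exact ⟨q, hq, hqn, hsq, fun hqc => hab (hpc.trans hqc.symm)⟩
  · exact ⟨p, hp, hpn, hsp, hpc⟩

theorem FullSetup.sfx_eq (h : FullSetup n σ T dollar SA BWT LCP w) {x : ℕ} (hx : 1 ≤ x)
    (hxn : x ≤ n) : sfx (Trev T n) n (SA x) = (seg T 1 (n - SA x)).reverse ++ [dollar] := by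
  rw [sfx_Trev T (h.hSAmem x hx hxn).2, h.hTn]

theorem FullSetup.exists_common_suffix (h : FullSetup n σ T dollar SA BWT LCP w) {x : ℕ}
    (hx : 1 ≤ x) (hxn : x + 1 ≤ n) :
    ∃ s : List ℤ, (s.length : ℤ) = LCP (x + 1) ∧ s <:+ seg T 1 (n - SA x) ∧
      s <:+ seg T 1 (n - SA (x + 1)) := by
  have hnot : ∀ y, 1 ≤ y → y ≤ n → dollar ∉ (seg T 1 (n - SA y)).reverse := by
    intro y hy hyn hmem
    have := h.hSAmem y hy hyn
    simp only [seg, List.mem_reverse, List.mem_map, List.mem_range] at hmem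
    obtain ⟨k, hk, hTk⟩ := hmem
    exact h.hTne _ (by omega) (by omega) hTk
  have hne : (seg T 1 (n - SA x)).reverse ≠ (seg T 1 (n - SA (x + 1))).reverse := by
    intro heq
    have hl := congrArg List.length heq
    simp only [List.length_reverse, length_seg] at hl
    have h1 := h.hSAmem x hx (by omega)
    have h2 := h.hSAmem (x + 1) (by omega) hxn
    have := h.hSAinj x (x + 1) hx (by omega) (by omega) hxn (by omega)
    omega
  obtain ⟨s, hs, h1, h2⟩ := lcpLen_append_sentinel dollar _ _ (hnot x hx (by omega))
    (hnot (x + 1) (by omega) hxn) hne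
  refine ⟨s.reverse, ?_, ?_, ?_⟩
  · rw [h.hLCP (x + 1) (by omega) hxn, List.length_reverse, hs, Nat.add_sub_cancel,
      h.sfx_eq hx (by omega), h.sfx_eq (by omega) hxn]
  · rwa [← List.reverse_prefix, List.reverse_reverse]
  · rwa [← List.reverse_prefix, List.reverse_reverse]

/-- At a change of the BWT, both neighbouring weights are at least the LCP value there. -/
theorem FullSetup.LCP_le_weight (h : FullSetup n σ T dollar SA BWT LCP w) {x : ℕ}
    (hx : 1 ≤ x) (hxn : x + 1 ≤ n) (hne : BWT x ≠ BWT (x + 1)) :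
    LCP (x + 1) ≤ w x ∧ LCP (x + 1) ≤ w (x + 1) := by
  obtain ⟨s, hs, h1, h2⟩ := h.exists_common_suffix hx hxn
  have hR := h.rightMax_of_suffix hx (by omega) (by omega) hxn h1 h2 hne
  exact ⟨(h.hwRB x hx (by omega) (Or.inr ⟨by omega, hne⟩) ⟨s, hR, h1⟩).2 ⟨s, hR, h1, hs.symm⟩,
    (h.hwRB (x + 1) (by omega) hxn (Or.inl ⟨by omega, hne.symm⟩) ⟨s, hR, h2⟩).2
      ⟨s, hR, h2, hs.symm⟩⟩

/-- LCP values inside the suffix array interval of a string are at least its length. -/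
theorem FullSetup.length_le_LCP (h : FullSetup n σ T dollar SA BWT LCP w) {s : List ℤ}
    {x y z : ℕ} (hx : 1 ≤ x) (hxz : x ≤ z) (hzy : z + 1 ≤ y) (hyn : y ≤ n)
    (hsx : s <:+ seg T 1 (n - SA x)) (hsy : s <:+ seg T 1 (n - SA y)) :
    (s.length : ℤ) ≤ LCP (z + 1) := by
  have hpre : ∀ u, 1 ≤ u → u ≤ n → s <:+ seg T 1 (n - SA u) →
      s.reverse <+: sfx (Trev T n) n (SA u) := fun u hu hun hsu => by
    rw [h.sfx_eq hu hun]
    exact (List.reverse_prefix.2 hsu).trans (List.prefix_append _ _)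
  have hord : ∀ u v, 1 ≤ u → u ≤ v → v ≤ n →
      List.Lex (· < ·) (sfx (Trev T n) n (SA u)) (sfx (Trev T n) n (SA v)) ∨
        sfx (Trev T n) n (SA u) = sfx (Trev T n) n (SA v) := fun u v hu huv hv => by
    rcases huv.eq_or_lt with rfl | huv
    · exact Or.inr rfl
    · exact Or.inl (h.hSAord u v hu huv hv)
  have hmid : ∀ u, x ≤ u → u ≤ y → s.reverse <+: sfx (Trev T n) n (SA u) := fun u hu huy =>
    prefix_of_lex_between _ _ _ _ (hpre x hx (by omega) hsx) (hpre y (by omega) hyn hsy)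
      (hord x u hx hu (by omega)) (hord u y (by omega) huy hyn)
  rw [h.hLCP (z + 1) (by omega) (by omega), Nat.add_sub_cancel]
  have := length_le_lcpLen _ _ _ (hmid z hxz (by omega)) (hmid (z + 1) (by omega) hzy)
  rw [List.length_reverse] at this
  exact_mod_cast this

/-- Inside a run, let `k` be the last index before `i` with a different BWT character. Then the
weight of `i` is bounded by `LCP (i + 1)` or `LCP (k + 1)`. -/
theorem FullSetup.weight_le_LCP_or (h : FullSetup n σ T dollar SA BWT LCP w) {i k : ℕ}
    (hi : 1 ≤ i) (hin : i + 1 ≤ n) (hend : BWT i ≠ BWT (i + 1))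
    (hrun : ∀ j, k < j → j < i → BWT j = BWT i) (hki : k < i) :
    w i ≤ LCP (i + 1) ∨ w i ≤ LCP (k + 1) := by
  obtain ⟨t, -, ht1, ht2⟩ := h.exists_common_suffix hi hin
  have htR := h.rightMax_of_suffix hi (by omega) (by omega) hin ht1 ht2 hend
  obtain ⟨s, hR, hs, hw⟩ :=
    (h.hwRB i hi (by omega) (Or.inr ⟨by omega, hend⟩) ⟨t, htR, ht1⟩).1
  obtain ⟨p, hp, hpn, hsp, hpc⟩ := h.exists_ne_of_rightMax hR (BWT i)
  rw [hw]
  rcases lt_trichotomy p i with hlt | rfl | hgt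
  · have hpk : p ≤ k := not_lt.1 fun hk => hpc (hrun p hk hlt)
    exact Or.inr (h.length_le_LCP hp hpk (by omega) (by omega) hsp hs)
  · exact absurd rfl hpc
  · exact Or.inl (h.length_le_LCP hi le_rfl hgt hpn hs hsp)

end

/-- Let `1 < i ≤ n`, `c := BWT[i]`, `w(i) ≥ 0`, `ℓ* := i` if `w(i) = LCP[i]` and
`ℓ* := i+1` otherwise, `curr_b := b(ℓ*)`. If `i = Candt_c(curr_b, i+1)` and `w(i) ≤ LCP[i]`,
then either `BWT[j] = c` for every `curr_b ≤ j < i`, or `BWT[j] ≠ c` for every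
`curr_b ≤ j < i`. -/
theorem stmt9 (n σ : ℕ) (T : ℕ → ℤ) (dollar : ℤ) (SA : ℕ → ℕ) (BWT LCP w : ℕ → ℤ)
    (hsetup : FullSetup n σ T dollar SA BWT LCP w)
    (i : ℕ) (hi1 : 1 < i) (hin : i ≤ n) (hwi : 0 ≤ w i)
    (lstar : ℕ) (hlstar : lstar = if w i = LCP i then i else i + 1)
    (currb : ℕ) (hcurrb : currb = bIdx LCP lstar)
    (hcand : (i : ℤ) = Candt BWT w (BWT i) currb (i + 1))
    (hwle : w i ≤ LCP i) :
    (∀ j, currb ≤ j → j < i → BWT j = BWT i) ∨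
      (∀ j, currb ≤ j → j < i → BWT j ≠ BWT i) := by
  have key : ∀ k, currb ≤ k → k < i → BWT k = BWT i → 0 ≤ w k → w k < w i := fun k h1 h2 h3 h4 =>
    weight_lt_of_eq_Candt hcand h1 h2 (by omega) h3 h4
  have hb : 1 ≤ currb := hcurrb ▸ bIdx_pos _ _
  obtain ⟨m, rfl⟩ : ∃ m, i = m + 1 := ⟨i - 1, by omega⟩
  by_cases hprev : BWT m = BWT (m + 1)
  · left
    intro j hbj hji
    by_contra hj
    obtain ⟨k, hjk, hki, hk, hk', hrun⟩ := exists_last_switch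
      (P := fun x => BWT x = BWT (m + 1)) hji hj hprev
    have hLw := (hsetup.LCP_le_weight (x := k) (by omega) (by omega) (by rwa [hk'])).2
    have hle : w (m + 1) ≤ LCP (k + 1) := by
      by_cases hwL : w (m + 1) = LCP (m + 1)
      · rw [if_pos hwL] at hlstar
        rw [hwL]
        rw [hcurrb, hlstar] at hbj
        exact le_of_bIdx_lt (by omega) hki
      · rw [if_neg hwL] at hlstar
        have hrb : RunBoundary BWT n (m + 1) := by
          by_contra hnot
          rw [hsetup.hwNot _ (by omega) hin hnot] at hwi
          omega
        rcases hrb with ⟨-, hstart⟩ | ⟨hlt, hend⟩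
        · exact absurd hprev.symm hstart
        · rcases hsetup.weight_le_LCP_or (by omega) hlt hend hrun (by omega) with hw | hw
          · rw [hcurrb, hlstar] at hbj
            exact hw.trans (le_of_bIdx_lt (by omega) (by omega))
          · exact hw
    have := key (k + 1) (by omega) hki hk' (by omega)
    omega
  · right
    intro j hbj hji hj
    have hwL : w (m + 1) = LCP (m + 1) :=
      le_antisymm hwle (hsetup.LCP_le_weight (by omega) hin hprev).2
    rw [if_pos hwL] at hlstar
    obtain ⟨k, hjk, hki, hk, hk', -⟩ := exists_last_switch
      (P := fun x => BWT x ≠ BWT (m + 1)) hji (not_not.2 hj) hprev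
    rw [not_not] at hk
    have hLw := (hsetup.LCP_le_weight (x := k) (by omega) (by omega)
      (by rw [hk]; exact hk'.symm)).1
    have hle : LCP (m + 1) ≤ LCP (k + 1) := by
      rw [hcurrb, hlstar] at hbj
      exact le_of_bIdx_lt (by omega) hki
    have := key k (by omega) (by omega) hk (by omega)
    omega
end

section
/- Let x be an index with 1 < x ≤ n and suppose y := b(x) satisfies y > 1. Then LCP[y] < LCP[s] for every index s with y < s ≤ x, and the string T^rev[SA[y]..SA[y]+LCP[y]-1] is a proper prefix of the string T^rev[SA[x]..SA[x]+LCP[x]-1]. -/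
open scoped Classical

theorem le_length_and_take_eq_of_le_lcpLen : ∀ (l₁ l₂ : List ℤ) (k : ℕ), k ≤ lcpLen l₁ l₂ →
    k ≤ l₁.length ∧ k ≤ l₂.length ∧ l₁.take k = l₂.take k
  | [], _, k, h | _ :: _, [], k, h => by
    obtain rfl : k = 0 := by simpa [lcpLen] using h
    simp
  | _ :: _, _ :: _, 0, _ => by simp
  | a :: l₁, b :: l₂, k + 1, h => by
    rw [lcpLen] at h
    split_ifs at h with hab
    · simpa [hab] using le_length_and_take_eq_of_le_lcpLen l₁ l₂ k (by omega)
    · omega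

theorem take_seg (T : ℕ → ℤ) (i : ℕ) {k len : ℕ} (h : k ≤ len) :
    (seg T i len).take k = seg T i k := by
  simp [seg, ← List.map_take, List.take_range, h]

theorem seg_eq_seg_of_le_lcpLen (T : ℕ → ℤ) (n p q k : ℕ)
    (h : k ≤ lcpLen (sfx T n p) (sfx T n q)) : seg T p k = seg T q k := by
  obtain ⟨hp, hq, heq⟩ := le_length_and_take_eq_of_le_lcpLen _ _ _ h
  rw [sfx, length_seg] at hp hq
  rwa [sfx, sfx, take_seg _ _ hp, take_seg _ _ hq] at heq

theorem bIdx_spec (L : ℕ → ℤ) (x : ℕ) (h : 1 < bIdx L x) :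
    bIdx L x < x ∧ L (bIdx L x) < L x := by
  have hmem := Nat.sSup_mem ⟨1, Or.inr rfl⟩ (bddAbove_bIdx_set L x)
  change (1 ≤ bIdx L x ∧ bIdx L x < x ∧ L (bIdx L x) < L x) ∨ bIdx L x = 1 at hmem
  rcases hmem with hmem | hmem
  · exact hmem.2
  · omega

theorem le_of_bIdx_lt_s16 (L : ℕ → ℤ) {x s : ℕ} (hs1 : 1 ≤ s) (hs : bIdx L x < s) (hsx : s ≤ x) :
    L x ≤ L s := by
  rcases hsx.eq_or_lt with rfl | hsx
  · rfl
  by_contra! hlt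
  exact hs.not_ge (le_csSup (bddAbove_bIdx_set L x) (Or.inl ⟨hs1, hsx, hlt⟩))

/-- Let `1 < x ≤ n` and suppose `y := b(x)` satisfies `y > 1`. Then
`LCP[y] < LCP[s]` for every `y < s ≤ x`, and `T^rev[SA[y]..SA[y]+LCP[y]-1]` is a proper
prefix of `T^rev[SA[x]..SA[x]+LCP[x]-1]`. -/
theorem stmt16 (n σ : ℕ) (T : ℕ → ℤ) (dollar : ℤ) (SA : ℕ → ℕ) (LCP : ℕ → ℤ)
    (hsetup : LCPSetup n σ T dollar SA LCP)
    (x : ℕ) (hx1 : 1 < x) (hxn : x ≤ n)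
    (y : ℕ) (hy : y = bIdx LCP x) (hy1 : 1 < y) :
    (∀ s, y < s → s ≤ x → LCP y < LCP s) ∧
      seg (Trev T n) (SA y) (LCP y).toNat <+: seg (Trev T n) (SA x) (LCP x).toNat ∧
      seg (Trev T n) (SA y) (LCP y).toNat ≠ seg (Trev T n) (SA x) (LCP x).toNat := by
  subst hy
  obtain ⟨hyx, hlt⟩ := bIdx_spec LCP x hy1
  set y := bIdx LCP x with hy
  have hmin : ∀ s, y < s → s ≤ x → LCP y < LCP s := fun s hys hsx =>
    hlt.trans_le (le_of_bIdx_lt_s16 LCP (by omega) hys hsx)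
  have hy0 : 0 ≤ LCP y := by rw [hsetup.hLCP y hy1 (by omega)]; positivity
  have hseg : ∀ s, y ≤ s → s ≤ x →
      seg (Trev T n) (SA y) (LCP y).toNat = seg (Trev T n) (SA s) (LCP y).toNat := by
    intro s hys
    induction s, hys using Nat.le_induction with
    | base => intro _; rfl
    | succ s hys ih =>
      intro hsx
      rw [ih (by omega)]
      apply seg_eq_seg_of_le_lcpLen _ n
      have hl := hsetup.hLCP (s + 1) (by omega) (by omega)
      rw [Nat.add_sub_cancel] at hl
      have := hmin (s + 1) (by omega) hsx
      omega
  refine ⟨hmin, ?_, fun heq => ?_⟩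
  · rw [hseg x hyx.le le_rfl, ← take_seg (Trev T n) (SA x) (Int.toNat_le_toNat hlt.le)]
    exact List.take_prefix _ _
  · have := congrArg List.length heq
    rw [length_seg, length_seg] at this
    omega
end
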